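/- (Birman–Ko–Lee) The classical and band presentations define isomorphic groups: the group homomorphism from the group with the Birman–Ko–Lee presentation to the braid group B_n that sends each generator σ_{s,t} (1 ≤ s < t ≤ n) to the band word (σ_{t−1} σ_{t−2} ⋯ σ_{s+1}) σ_s (σ_{s+1}⁻¹ ⋯ σ_{t−1}⁻¹) is a well-defined isomorphism of groups. -/

import Mathlib

/-- The set of relators for Artin's classical presentation of the braid group `Bₙ`:
generators `σ₁, …, σ_{n-1}` (indexed by `Fin (n-1)`), with relations
`σᵢ σₖ = σₖ σᵢ` when `|i - k| ≥ 2` and `σᵢ σ_{i+1} σᵢ = σ_{i+1} σᵢ σ_{i+1}`. -/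
def braidRels (n : ℕ) : Set (FreeGroup (Fin (n - 1))) :=
  {w | (∃ i k : Fin (n - 1), (i : ℕ) + 2 ≤ (k : ℕ) ∧
          w = FreeGroup.of i * FreeGroup.of k * (FreeGroup.of k * FreeGroup.of i)⁻¹) ∨
       (∃ i k : Fin (n - 1), (i : ℕ) + 1 = (k : ℕ) ∧
          w = FreeGroup.of i * FreeGroup.of k * FreeGroup.of i *
              (FreeGroup.of k * FreeGroup.of i * FreeGroup.of k)⁻¹)}

/-- The braid group `Bₙ`, given by Artin's classical presentation. -/
abbrev BraidGroup (n : ℕ) : Type := PresentedGroup (braidRels n)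

/-- The generator `σ_{i+1}` of `Bₙ` for a natural-number index `i < n - 1`
(junk value `1` otherwise). -/
def sigmaB (n : ℕ) (i : ℕ) : BraidGroup n :=
  if h : i < n - 1 then PresentedGroup.of (⟨i, h⟩ : Fin (n - 1)) else 1

/-- The band generator of `Bₙ` joining (0-indexed) strands `a < b`; in 1-indexed classical
notation, `σ_{s,t} = (σ_{t-1} ⋯ σ_{s+1}) σ_s (σ_{s+1}⁻¹ ⋯ σ_{t-1}⁻¹)` where `s = a+1`,
`t = b+1`.  Defined recursively: `band a (a+1) = σ_{a+1}` and
`band a (b+1) = σ_{b+1} · band a b · σ_{b+1}⁻¹`. -/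
def bandWord (n a : ℕ) : ℕ → BraidGroup n
  | 0 => 1
  | b + 1 => if b = a then sigmaB n a else sigmaB n b * bandWord n a b * (sigmaB n b)⁻¹

/-- Index set for the Birman–Ko–Lee generators: pairs of strands `s < t` (0-indexed). -/
abbrev BKLIdx (n : ℕ) : Type := {p : Fin n × Fin n // p.1 < p.2}

/-- Relators of the Birman–Ko–Lee (band) presentation:
`σ_{s,t} σ_{q,r} = σ_{q,r} σ_{s,t}` whenever `(t-r)(t-q)(s-r)(s-q) > 0`, and
`σ_{s,t} σ_{r,s} = σ_{r,t} σ_{s,t} = σ_{r,s} σ_{r,t}` whenever `r < s < t`. -/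
def bklRels (n : ℕ) : Set (FreeGroup (BKLIdx n)) :=
  {w | (∃ p q : BKLIdx n,
          (((p.1.2 : ℕ) : ℤ) - ((q.1.2 : ℕ) : ℤ)) * (((p.1.2 : ℕ) : ℤ) - ((q.1.1 : ℕ) : ℤ)) *
            (((p.1.1 : ℕ) : ℤ) - ((q.1.2 : ℕ) : ℤ)) *
            (((p.1.1 : ℕ) : ℤ) - ((q.1.1 : ℕ) : ℤ)) > 0 ∧
          w = FreeGroup.of p * FreeGroup.of q * (FreeGroup.of q * FreeGroup.of p)⁻¹) ∨
       (∃ (r s t : Fin n) (hrs : r < s) (hst : s < t),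
          w = FreeGroup.of ⟨(s, t), hst⟩ * FreeGroup.of ⟨(r, s), hrs⟩ *
              (FreeGroup.of ⟨(r, t), hrs.trans hst⟩ * FreeGroup.of ⟨(s, t), hst⟩)⁻¹ ∨
          w = FreeGroup.of ⟨(s, t), hst⟩ * FreeGroup.of ⟨(r, s), hrs⟩ *
              (FreeGroup.of ⟨(r, s), hrs⟩ * FreeGroup.of ⟨(r, t), hrs.trans hst⟩)⁻¹)}

/-- The group defined by the Birman–Ko–Lee (band) presentation. -/
abbrev BKLGroup (n : ℕ) : Type := PresentedGroup (bklRels n)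

theorem sigmaB_commute (n : ℕ) {i k : ℕ} (h : i + 2 ≤ k) :
    Commute (sigmaB n i) (sigmaB n k) := by
  by_cases hk : k < n - 1
  · have hi : i < n - 1 := by omega
    simp only [sigmaB, hk, hi, dif_pos]
    exact PresentedGroup.mk_eq_mk_of_mul_inv_mem (rels := braidRels n)
      (x := FreeGroup.of ⟨i, hi⟩ * FreeGroup.of ⟨k, hk⟩)
      (y := FreeGroup.of ⟨k, hk⟩ * FreeGroup.of ⟨i, hi⟩)
      (Or.inl ⟨⟨i, hi⟩, ⟨k, hk⟩, h, rfl⟩)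
  · simp [sigmaB, hk]

theorem sigmaB_braid (n : ℕ) {i : ℕ} (h : i + 1 < n - 1) :
    sigmaB n i * sigmaB n (i + 1) * sigmaB n i =
      sigmaB n (i + 1) * sigmaB n i * sigmaB n (i + 1) := by
  have hi : i < n - 1 := by omega
  simp only [sigmaB, h, hi, dif_pos]
  exact PresentedGroup.mk_eq_mk_of_mul_inv_mem (rels := braidRels n)
    (x := FreeGroup.of ⟨i, hi⟩ * FreeGroup.of ⟨i + 1, h⟩ * FreeGroup.of ⟨i, hi⟩)
    (y := FreeGroup.of ⟨i + 1, h⟩ * FreeGroup.of ⟨i, hi⟩ * FreeGroup.of ⟨i + 1, h⟩)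
    (Or.inr ⟨⟨i, hi⟩, ⟨i + 1, h⟩, rfl, rfl⟩)

theorem bandWord_self_succ (n a : ℕ) : bandWord n a (a + 1) = sigmaB n a := by
  simp [bandWord]

theorem bandWord_succ (n : ℕ) {a b : ℕ} (h : a < b) :
    bandWord n a (b + 1) = sigmaB n b * bandWord n a b * (sigmaB n b)⁻¹ := by
  rw [bandWord, if_neg h.ne']

/-- An element commuting with every generator `σᵢ`, `a ≤ i < b`, commutes with the band
generator joining the strands `a` and `b`. -/
theorem commute_bandWord (n : ℕ) {a b : ℕ} (hab : a < b) {g : BraidGroup n}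
    (hg : ∀ i, a ≤ i → i < b → Commute g (sigmaB n i)) : Commute g (bandWord n a b) := by
  induction b, hab using Nat.le_induction with
  | base => rw [bandWord_self_succ]; exact hg a le_rfl (Nat.lt_succ_self a)
  | succ b hb ih =>
    have hgb := hg b (by omega) (Nat.lt_succ_self b)
    rw [bandWord_succ n hb]
    exact (hgb.mul_right (ih fun i h₁ h₂ => hg i h₁ (by omega))).mul_right hgb.inv_right

theorem sigmaB_commute_bandWord_of_lt (n : ℕ) {a b k : ℕ} (hab : a < b) (hk : b < k) :
    Commute (sigmaB n k) (bandWord n a b) :=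
  commute_bandWord n hab fun _ _ _ => (sigmaB_commute n (by omega)).symm

theorem sigmaB_commute_bandWord_of_between (n : ℕ) {a b i : ℕ} (hai : a < i)
    (hib : i + 2 ≤ b) (hb : b < n) : Commute (sigmaB n i) (bandWord n a b) := by
  induction b, hib using Nat.le_induction with
  | base =>
    have hbr := sigmaB_braid n (i := i) (by omega)
    have hc := sigmaB_commute_bandWord_of_lt n hai (Nat.lt_succ_self i)
    rw [bandWord_succ n (by omega), bandWord_succ n hai]
    simp only [Nat.succ_eq_add_one] at hc
    generalize sigmaB n (i + 1) = y at *
    generalize sigmaB n i = x at *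
    generalize bandWord n a i = w at *
    have hs : SemiconjBy (y * x) y x := by
      simpa [SemiconjBy, mul_assoc] using hbr.symm
    have hw : Commute (y * x * y * (y * x)⁻¹) (y * x * w * (y * x)⁻¹) :=
      hc.map (MulAut.conj (y * x)).toMonoidHom
    rw [show y * x * y * (y * x)⁻¹ = x by rw [hs.eq, mul_inv_cancel_right]] at hw
    simpa [mul_assoc] using hw
  | succ b hib ih =>
    have hc := sigmaB_commute n hib
    rw [bandWord_succ n (by omega)]
    exact (hc.mul_right (ih (by omega))).mul_right hc.inv_right

theorem bandWord_commute_of_disjoint (n : ℕ) {a b c d : ℕ} (hab : a < b) (hbc : b < c)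
    (hcd : c < d) : Commute (bandWord n a b) (bandWord n c d) :=
  commute_bandWord n hcd fun _ _ _ =>
    (sigmaB_commute_bandWord_of_lt n hab (by omega)).symm

theorem bandWord_commute_of_nested (n : ℕ) {a b c d : ℕ} (hac : a < c) (hcd : c < d)
    (hdb : d < b) (hb : b < n) : Commute (bandWord n a b) (bandWord n c d) :=
  commute_bandWord n hcd fun _ _ _ =>
    (sigmaB_commute_bandWord_of_between n (by omega) (by omega) hb).symm

theorem lt_or_nested_of_prod_pos {a b c d : ℤ}
    (h : (b - d) * (b - c) * (a - d) * (a - c) > 0) :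
    b < c ∨ d < a ∨ (a < c ∧ d < b) ∨ (c < a ∧ b < d) := by
  by_contra! hcon
  obtain ⟨h₁, h₂, h₃, h₄⟩ := hcon
  have hbc : 0 ≤ (b - c) * (d - a) := mul_nonneg (by omega) (by omega)
  have had : (b - d) * (a - c) ≥ 0 := by
    rcases lt_trichotomy a c with h | rfl | h
    · exact mul_nonneg_of_nonpos_of_nonpos (by have := h₃ h; omega) (by omega)
    · simp
    · exact mul_nonneg (by have := h₄ h; omega) (by omega)
  nlinarith [mul_nonneg hbc had]

theorem bandWord_commute_of_noncrossing (n : ℕ) {a b c d : ℕ} (hab : a < b) (hcd : c < d)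
    (hb : b < n) (hd : d < n)
    (h : ((b : ℤ) - d) * ((b : ℤ) - c) * ((a : ℤ) - d) * ((a : ℤ) - c) > 0) :
    Commute (bandWord n a b) (bandWord n c d) := by
  rcases lt_or_nested_of_prod_pos h with h | h | h | h
  · exact bandWord_commute_of_disjoint n hab (by omega) hcd
  · exact (bandWord_commute_of_disjoint n hcd (by omega) hab).symm
  · exact bandWord_commute_of_nested n (by omega) hcd (by omega) hb
  · exact (bandWord_commute_of_nested n (by omega) hab (by omega) hd).symm

theorem bandWord_braid_sigmaB (n : ℕ) {r s : ℕ} (hrs : r < s) (hs : s + 1 < n) :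
    bandWord n r s * sigmaB n s * bandWord n r s =
      sigmaB n s * bandWord n r s * sigmaB n s := by
  induction s, hrs using Nat.le_induction with
  | base => rw [bandWord_self_succ]; exact sigmaB_braid n (by omega)
  | succ s hrs ih =>
    have hbr := sigmaB_braid n (i := s) (by omega)
    have hc := sigmaB_commute_bandWord_of_lt n hrs (Nat.lt_succ_self s)
    specialize ih (by omega)
    rw [bandWord_succ n hrs]
    simp only [Nat.succ_eq_add_one] at hc
    generalize sigmaB n (s + 1) = y at *
    generalize sigmaB n s = x at *
    generalize bandWord n r s = w at *
    have hx : x * w * x⁻¹ = w⁻¹ * x * w := by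
      rw [mul_inv_eq_iff_eq_mul, mul_assoc, mul_assoc, eq_inv_mul_iff_mul_eq, ← mul_assoc,
        ← mul_assoc, ih]
    have hy : y = w⁻¹ * y * w := by
      rw [mul_assoc, hc.eq, inv_mul_cancel_left]
    have := congrArg (fun g => w⁻¹ * g * w) hbr
    rw [hx, hy]
    simpa [mul_assoc] using this

theorem bandWord_mul_eq_mul_left (n : ℕ) {r s t : ℕ} (hrs : r < s) (hst : s < t) :
    bandWord n s t * bandWord n r s = bandWord n r t * bandWord n s t := by
  induction t, hst using Nat.le_induction with
  | base => rw [bandWord_self_succ, bandWord_succ n hrs, inv_mul_cancel_right]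
  | succ t hst ih =>
    have hc := sigmaB_commute_bandWord_of_lt n hrs hst
    rw [bandWord_succ n hst, bandWord_succ n (hrs.trans hst), mul_assoc, hc.inv_left.eq]
    have := congrArg (fun g => sigmaB n t * g * (sigmaB n t)⁻¹) ih
    simpa [mul_assoc] using this

theorem bandWord_mul_eq_mul_right (n : ℕ) {r s t : ℕ} (hrs : r < s) (hst : s < t)
    (ht : t < n) :
    bandWord n s t * bandWord n r s = bandWord n r s * bandWord n r t := by
  induction t, hst using Nat.le_induction with
  | base =>
    rw [bandWord_self_succ, bandWord_succ n hrs, ← mul_assoc, eq_mul_inv_iff_mul_eq,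
      ← mul_assoc, bandWord_braid_sigmaB n hrs ht]
  | succ t hst ih =>
    have hc := sigmaB_commute_bandWord_of_lt n hrs hst
    have := congrArg (fun g => sigmaB n t * g * (sigmaB n t)⁻¹) (ih (by omega))
    rw [bandWord_succ n hst, bandWord_succ n (hrs.trans hst), mul_assoc, hc.inv_left.eq,
      ← mul_assoc (bandWord n r s), ← mul_assoc (bandWord n r s), ← hc.eq]
    simpa [mul_assoc] using this

/-- The homomorphism from the band presentation to the braid group. -/
def bklToBraid (n : ℕ) : BKLGroup n →* BraidGroup n :=
  PresentedGroup.toGroup (f := fun p : BKLIdx n => bandWord n p.1.1 p.1.2) (by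
    rintro w (⟨p, q, h, rfl⟩ | ⟨r, s, t, hrs, hst, rfl | rfl⟩) <;>
      simp only [map_mul, map_inv, FreeGroup.lift_apply_of, mul_inv_eq_one]
    · exact bandWord_commute_of_noncrossing n p.2 q.2 p.1.2.2 q.1.2.2 h
    · exact bandWord_mul_eq_mul_left n hrs hst
    · exact bandWord_mul_eq_mul_right n hrs hst t.2)

theorem bklToBraid_of (n : ℕ) (p : BKLIdx n) :
    bklToBraid n (PresentedGroup.of p) = bandWord n p.1.1 p.1.2 :=
  PresentedGroup.toGroup.of _

theorem bkl_of_commute {n : ℕ} {p q : BKLIdx n} (h : p.1.2 < q.1.1) :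
    Commute (PresentedGroup.of p : BKLGroup n) (PresentedGroup.of q) := by
  refine PresentedGroup.mk_eq_mk_of_mul_inv_mem
    (x := FreeGroup.of p * FreeGroup.of q) (y := FreeGroup.of q * FreeGroup.of p)
    (Or.inl ⟨p, q, ?_, rfl⟩)
  have hp : (p.1.1 : ℕ) < p.1.2 := p.2
  have hq : (q.1.1 : ℕ) < q.1.2 := q.2
  have h' : (p.1.2 : ℕ) < q.1.1 := h
  exact mul_pos_of_neg_of_neg (mul_neg_of_pos_of_neg
    (mul_pos_of_neg_of_neg (by omega) (by omega)) (by omega)) (by omega)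

theorem bkl_of_mul_of_eq_left {n : ℕ} {r s t : Fin n} (hrs : r < s) (hst : s < t) :
    (PresentedGroup.of ⟨(s, t), hst⟩ * PresentedGroup.of ⟨(r, s), hrs⟩ : BKLGroup n) =
      PresentedGroup.of ⟨(r, t), hrs.trans hst⟩ * PresentedGroup.of ⟨(s, t), hst⟩ :=
  PresentedGroup.mk_eq_mk_of_mul_inv_mem (Or.inr ⟨r, s, t, hrs, hst, Or.inl rfl⟩)

theorem bkl_of_mul_of_eq_right {n : ℕ} {r s t : Fin n} (hrs : r < s) (hst : s < t) :
    (PresentedGroup.of ⟨(s, t), hst⟩ * PresentedGroup.of ⟨(r, s), hrs⟩ : BKLGroup n) =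
      PresentedGroup.of ⟨(r, s), hrs⟩ * PresentedGroup.of ⟨(r, t), hrs.trans hst⟩ :=
  PresentedGroup.mk_eq_mk_of_mul_inv_mem (Or.inr ⟨r, s, t, hrs, hst, Or.inr rfl⟩)

/-- The pair of adjacent strands `i`, `i + 1`. -/
def adjacentIdx {n : ℕ} (i : Fin (n - 1)) : BKLIdx n :=
  ⟨(⟨i, by omega⟩, ⟨i + 1, by omega⟩), Nat.lt_succ_self _⟩

/-- The homomorphism from the braid group to the band presentation. -/
def braidToBKL (n : ℕ) : BraidGroup n →* BKLGroup n :=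
  PresentedGroup.toGroup (f := fun i => PresentedGroup.of (adjacentIdx i)) (by
    rintro w (⟨i, k, h, rfl⟩ | ⟨⟨i, hi⟩, ⟨k, hk⟩, h, rfl⟩) <;>
      simp only [map_mul, map_inv, FreeGroup.lift_apply_of, mul_inv_eq_one]
    · exact bkl_of_commute (Fin.mk_lt_mk.2 h)
    · obtain rfl : i + 1 = k := h
      have h₁ := bkl_of_mul_of_eq_left (adjacentIdx ⟨i, hi⟩).2 (adjacentIdx ⟨i + 1, hk⟩).2
      have h₂ := bkl_of_mul_of_eq_right (adjacentIdx ⟨i, hi⟩).2 (adjacentIdx ⟨i + 1, hk⟩).2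
      exact (mul_assoc _ _ _).trans ((congrArg _ h₁).trans ((mul_assoc _ _ _).symm.trans
        (congrArg (· * _) h₂.symm))))

theorem braidToBKL_of (n : ℕ) (i : Fin (n - 1)) :
    braidToBKL n (PresentedGroup.of i) = PresentedGroup.of (adjacentIdx i) :=
  PresentedGroup.toGroup.of _

theorem braidToBKL_bandWord (n : ℕ) {a b : ℕ} (hab : a < b) (hb : b < n) :
    braidToBKL n (bandWord n a b) =
      PresentedGroup.of ⟨(⟨a, hab.trans hb⟩, ⟨b, hb⟩), hab⟩ := by
  induction b, hab using Nat.le_induction with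
  | base =>
    rw [bandWord_self_succ, sigmaB, dif_pos (by omega), braidToBKL_of]
    rfl
  | succ b hab ih =>
    rw [bandWord_succ n hab, sigmaB, dif_pos (by omega), map_mul, map_mul, map_inv,
      ih (by omega), braidToBKL_of, mul_inv_eq_iff_eq_mul]
    exact bkl_of_mul_of_eq_left (r := ⟨a, by omega⟩) (s := ⟨b, by omega⟩)
      (t := ⟨b + 1, hb⟩) hab (Nat.lt_succ_self b)

theorem braidToBKL_comp_bklToBraid (n : ℕ) :
    (braidToBKL n).comp (bklToBraid n) = MonoidHom.id _ := by
  refine PresentedGroup.ext fun p => ?_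
  rw [MonoidHom.comp_apply, bklToBraid_of, braidToBKL_bandWord n p.2 p.1.2.2]
  rfl

theorem bklToBraid_comp_braidToBKL (n : ℕ) :
    (bklToBraid n).comp (braidToBKL n) = MonoidHom.id _ := by
  refine PresentedGroup.ext fun i => ?_
  rw [MonoidHom.comp_apply, braidToBKL_of, bklToBraid_of]
  exact (bandWord_self_succ n i).trans (dif_pos i.2)

/-- (Birman–Ko–Lee) The homomorphism from the group with the Birman–Ko–Lee presentation
to the braid group `Bₙ` sending each generator `σ_{s,t}` to the corresponding band word
is a well-defined isomorphism of groups. -/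
theorem bkl_presentation_isomorphism (n : ℕ) :
    ∃ φ : BKLGroup n →* BraidGroup n,
      (∀ (s t : Fin n) (h : s < t),
        φ (PresentedGroup.of ⟨(s, t), h⟩) = bandWord n (s : ℕ) (t : ℕ)) ∧
      Function.Bijective φ :=
  ⟨bklToBraid n, fun _ _ _ => bklToBraid_of n _,
    Function.bijective_iff_has_inverse.2 ⟨braidToBKL n,
      DFunLike.congr_fun (braidToBKL_comp_bklToBraid n),
      DFunLike.congr_fun (bklToBraid_comp_braidToBKL n)⟩⟩
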